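/- Suppose ξ, ζ are initial segments of I with ξ ⊆ ζ, X ∈ IPe(ζ), Y ∈ IPe(ξ), and Y ⊆ X↾ξ. Then Z = X ∩ (Y↾⁻¹ζ) belongs to IPe(ζ). -/

import Mathlib

open Set

abbrev Cantor : Type := ℕ → Bool

section
variable {I : Type}

/-- Restriction of a point of `D^η` to `D^ξ` (for `ξ ⊆ η`). -/
def restrictFn {ξ η : Set I} (h : ξ ⊆ η) (x : ↥η → Cantor) : ↥ξ → Cantor :=
  fun j => x ⟨j.1, h j.2⟩

/-- Projection `X↾ξ` of a set `X ⊆ D^η`. -/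
def resSet {ξ η : Set I} (h : ξ ⊆ η) (X : Set (↥η → Cantor)) : Set (↥ξ → Cantor) :=
  restrictFn h '' X

/-- Inverse projection `Y↾⁻¹η` of a set `Y ⊆ D^ξ`. -/
def resPre {ξ η : Set I} (h : ξ ⊆ η) (Y : Set (↥ξ → Cantor)) : Set (↥η → Cantor) :=
  {y | restrictFn h y ∈ Y}

/-- `A` is (relatively) open in `B`. -/
def RelOpen {α : Type*} [TopologicalSpace α] (A B : Set α) : Prop :=
  ∃ U, IsOpen U ∧ A = U ∩ B

/-- `A` is (relatively) closed in `B`. -/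
def RelClosed {α : Type*} [TopologicalSpace α] (A B : Set α) : Prop :=
  ∃ U, IsClosed U ∧ A = U ∩ B

/-- `A` is (relatively) clopen in `B`. -/
def RelClopen {α : Type*} [TopologicalSpace α] (A B : Set α) : Prop :=
  RelOpen A B ∧ RelClosed A B

open Classical in
/-- The union `x ∪ y` of two partial points agreeing on the common domain. -/
noncomputable def glue {ξ η : Set I} (x : ↥ξ → Cantor) (y : ↥η → Cantor) :
    ↥(ξ ∪ η) → Cantor :=
  fun j => if h : j.1 ∈ ξ then x ⟨j.1, h⟩
           else y ⟨j.1, ((Set.mem_union j.1 ξ η).mp j.2).resolve_left h⟩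

variable [PartialOrder I]

/-- `[<i]`. -/
def seg (i : I) : Set I := {j | j < i}

/-- `[≤i]`. -/
def segLe (i : I) : Set I := {j | j ≤ i}

/-- `[≯i]`. -/
def segNG (i : I) : Set I := {j | ¬ i < j}

lemma seg_subset {ζ : Set I} (hζ : IsLowerSet ζ) {i : I} (hi : i ∈ ζ) : seg i ⊆ ζ :=
  fun _ hj => hζ (le_of_lt hj) hi

lemma segLe_subset {ζ : Set I} (hζ : IsLowerSet ζ) {i : I} (hi : i ∈ ζ) : segLe i ⊆ ζ :=
  fun _ hj => hζ hj hi

lemma isLowerSet_segLe (i : I) : IsLowerSet (segLe i) :=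
  fun _ _ hba ha => le_trans hba ha

lemma seg_subset_segLe (i : I) : seg i ⊆ segLe i :=
  fun _ hj => le_of_lt hj

lemma mem_segLe_self (i : I) : i ∈ segLe i := le_refl i

/-- `D_{Xz}(i) = {x(i) : x ∈ X, x↾(<i) = z}`. -/
def Dxz {ζ : Set I} (X : Set (↥ζ → Cantor)) {i : I} (hi : i ∈ ζ) (h : seg i ⊆ ζ)
    (z : ↥(seg i) → Cantor) : Set Cantor :=
  {c | ∃ x ∈ X, restrictFn h x = z ∧ x ⟨i, hi⟩ = c}

/-- Pre-conditions `IPe(ζ)`. -/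
def IPe (ζ : Set I) (hζ : IsLowerSet ζ) (X : Set (↥ζ → Cantor)) : Prop :=
  -- P-1
  (IsClosed X ∧ X.Nonempty) ∧
  -- P-2
  (∀ (i : I) (hi : i ∈ ζ), ∀ z ∈ resSet (seg_subset hζ hi) X,
      Perfect (Dxz X hi (seg_subset hζ hi) z)) ∧
  -- P-3
  (∀ (i : I) (hi : i ∈ ζ), ∀ G : Set Cantor, IsOpen G →
      RelOpen
        ({z | ∃ x ∈ X, x ⟨i, hi⟩ ∈ G ∧ restrictFn (seg_subset hζ hi) x = z} :
          Set (↥(seg i) → Cantor))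
        (resSet (seg_subset hζ hi) X)) ∧
  -- P-4
  (∀ ξ η : Set I, IsLowerSet ξ → IsLowerSet η → ∀ (hξ : ξ ⊆ ζ) (hη : η ⊆ ζ),
      ∀ x ∈ resSet hξ X, ∀ y ∈ resSet hη X,
        restrictFn (Set.inter_subset_left : ξ ∩ η ⊆ ξ) x =
          restrictFn (Set.inter_subset_right : ξ ∩ η ⊆ η) y →
        glue x y ∈ resSet (Set.union_subset hξ hη) X)

/-- `stem(A)`: the length of the longest common initial segment of members of `A`. -/
noncomputable def stem (A : Set Cantor) : ℕ :=
  sInf {n | ∃ a ∈ A, ∃ b ∈ A, a n ≠ b n}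

/-- `Spl(A,e)` for `A ⊆ D`. -/
def SplD (A : Set Cantor) (e : Bool) : Set Cantor :=
  {a ∈ A | a (stem A) = e}

/-- `Spl(X,i,e)` for `X ⊆ D^ζ`. -/
def Spl {ζ : Set I} (hζ : IsLowerSet ζ) (X : Set (↥ζ → Cantor)) {i : I} (hi : i ∈ ζ)
    (e : Bool) : Set (↥ζ → Cantor) :=
  {x ∈ X |
    x ⟨i, hi⟩ ∈
      SplD (Dxz X hi (seg_subset hζ hi) (restrictFn (seg_subset hζ hi) x)) e}

/-- A `ζ`-admissible function: `Φ : ω → ζ` taking each value of `ζ` infinitely often. -/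
def Admissible (ζ : Set I) (Φ : ℕ → I) : Prop :=
  (∀ n, Φ n ∈ ζ) ∧ ∀ i ∈ ζ, ∀ N : ℕ, ∃ n, N ≤ n ∧ Φ n = i

/-- The sets `X_Φ[u]` for finite binary sequences `u`. -/
def XPhi {ζ : Set I} (hζ : IsLowerSet ζ) (Φ : ℕ → I) (hΦ : ∀ n, Φ n ∈ ζ)
    (X : Set (↥ζ → Cantor)) : (m : ℕ) → (Fin m → Bool) → Set (↥ζ → Cantor)
  | 0, _ => X
  | m + 1, u =>
      Spl hζ (XPhi hζ Φ hΦ X m (fun k => u k.castSucc)) (hΦ m) (u (Fin.last m))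

/-- `X` is shrinkable: each `X_Φ[a]` is a singleton. -/
def Shrinkable {ζ : Set I} (hζ : IsLowerSet ζ) (X : Set (↥ζ → Cantor)) : Prop :=
  ∀ (Φ : ℕ → I) (hΦ : Admissible ζ Φ) (a : ℕ → Bool),
    ∃ x, (⋂ m : ℕ, XPhi hζ Φ hΦ.1 X m (fun k => a k.1)) = {x}

/-- Conditions `Pe(ζ)`: shrinkable pre-conditions. -/
def Pe (ζ : Set I) (hζ : IsLowerSet ζ) (X : Set (↥ζ → Cantor)) : Prop :=
  IPe ζ hζ X ∧ Shrinkable hζ X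

/-- `Perf = Pe(I)`. -/
def Perf (X : Set (↥(Set.univ : Set I) → Cantor)) : Prop :=
  Pe Set.univ isLowerSet_univ X

/-- The initial segments `ξ[u,v]`. -/
def xiUV (Φ : ℕ → I) : (m : ℕ) → (Fin m → Bool) → (Fin m → Bool) → Set I
  | 0, _, _ => Set.univ
  | m + 1, u, v =>
      if u (Fin.last m) = v (Fin.last m) then
        xiUV Φ m (fun k => u k.castSucc) (fun k => v k.castSucc)
      else
        xiUV Φ m (fun k => u k.castSucc) (fun k => v k.castSucc) ∩ segNG (Φ m)

/-- A `Φ`-splitting system of order `m`. -/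
def SplittingSystem (Φ : ℕ → I) (m : ℕ)
    (X : (n : ℕ) → (Fin n → Bool) → Set (↥(Set.univ : Set I) → Cantor)) : Prop :=
  (∀ n, n ≤ m → ∀ u : Fin n → Bool, Perf (X n u)) ∧
  -- S-1
  (∀ n, n < m → ∀ (u : Fin n → Bool) (e : Bool),
      X (n + 1) (Fin.snoc u e) ⊆
        Spl isLowerSet_univ (X n u) (Set.mem_univ (Φ n)) e) ∧
  -- S-2
  (∀ n, n ≤ m → ∀ u v : Fin n → Bool,
      resSet (Set.subset_univ (xiUV Φ n u v)) (X n u) =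
        resSet (Set.subset_univ (xiUV Φ n u v)) (X n v)) ∧
  -- S-3
  (∀ n, n ≤ m → ∀ u v : Fin n → Bool, ∀ i : I, i ∉ xiUV Φ n u v →
      resSet (Set.subset_univ (segLe i)) (X n u) ∩
        resSet (Set.subset_univ (segLe i)) (X n v) = ∅)

/-- `F` is reducible to `ξ` on `X`. -/
def Reducible {β : Type*} (F : (↥(Set.univ : Set I) → Cantor) → β) (ξ : Set I)
    (X : Set (↥(Set.univ : Set I) → Cantor)) : Prop :=
  ∀ x ∈ X, ∀ y ∈ X,
    restrictFn (Set.subset_univ ξ) x = restrictFn (Set.subset_univ ξ) y → F x = F y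

/-- `F` captures `i` on `X`. -/
def Captures {β : Type*} (F : (↥(Set.univ : Set I) → Cantor) → β) (i : I)
    (X : Set (↥(Set.univ : Set I) → Cantor)) : Prop :=
  ∀ x ∈ X, ∀ y ∈ X, F x = F y → x ⟨i, Set.mem_univ i⟩ = y ⟨i, Set.mem_univ i⟩

/-- Borel sets of finite level: level `0` = closed sets, level `n+1` = countable
unions or countable intersections of sets of level `n`. -/
def BorelLevel {α : Type*} [TopologicalSpace α] : ℕ → Set (Set α)
  | 0 => {C | IsClosed C}
  | n + 1 =>
      {S | (∃ f : ℕ → Set α, (∀ k, f k ∈ BorelLevel n) ∧ S = ⋃ k, f k) ∨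
           (∃ f : ℕ → Set α, (∀ k, f k ∈ BorelLevel n) ∧ S = ⋂ k, f k)}

end

section
variable {I : Type}

lemma continuous_restrictFn {ξ η : Set I} (h : ξ ⊆ η) :
    Continuous (restrictFn h : (↥η → Cantor) → (↥ξ → Cantor)) :=
  continuous_pi fun _ => continuous_apply _

lemma resSet_inter_resPre {ξ ζ : Set I} {X : Set (↥ζ → Cantor)} {Y : Set (↥ξ → Cantor)}
    (hsub : ξ ⊆ ζ) (hYsub : Y ⊆ resSet hsub X) :
    resSet hsub (X ∩ resPre hsub Y) = Y := by
  ext y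
  constructor
  · rintro ⟨x, hx, rfl⟩
    exact hx.2
  · intro hy
    obtain ⟨x, hx, rfl⟩ := hYsub hy
    exact ⟨x, ⟨hx, hy⟩, rfl⟩

lemma resSet_resSet {ρ ξ ζ : Set I} (h : ρ ⊆ ξ) (h' : ξ ⊆ ζ) (X : Set (↥ζ → Cantor)) :
    resSet h (resSet h' X) = resSet (h.trans h') X :=
  image_image _ _ _

variable [PartialOrder I]

/-- Two points of an `IPe` set agreeing on `ξ ∩ η` have a common amalgam inside the set. -/
lemma IPe.exists_amalgam {ζ : Set I} {hζ : IsLowerSet ζ} {X : Set (↥ζ → Cantor)}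
    (hX : IPe ζ hζ X) {ξ η : Set I} (hξ : IsLowerSet ξ) (hη : IsLowerSet η)
    (hξζ : ξ ⊆ ζ) (hηζ : η ⊆ ζ) {a b : ↥ζ → Cantor} (ha : a ∈ X) (hb : b ∈ X)
    (hab : ∀ j : ↥ζ, j.1 ∈ ξ → j.1 ∈ η → a j = b j) :
    ∃ c ∈ X, (∀ j : ↥ζ, j.1 ∈ ξ → c j = a j) ∧ (∀ j : ↥ζ, j.1 ∈ η → c j = b j) := by
  obtain ⟨c, hc, hcg⟩ := hX.2.2.2 ξ η hξ hη hξζ hηζ _ ⟨a, ha, rfl⟩ _ ⟨b, hb, rfl⟩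
    (funext fun j => hab ⟨j.1, hξζ j.2.1⟩ j.2.1 j.2.2)
  have key : ∀ (j : ↥ζ) (h : j.1 ∈ ξ ∪ η),
      c j = glue (restrictFn hξζ a) (restrictFn hηζ b) ⟨j.1, h⟩ :=
    fun j h => congrFun hcg ⟨j.1, h⟩
  refine ⟨c, hc, fun j hj => ?_, fun j hj => ?_⟩
  · rw [key j (Or.inl hj)]
    simp [glue, hj, restrictFn]
  · rw [key j (Or.inr hj)]
    by_cases h : j.1 ∈ ξ
    · simpa [glue, h, restrictFn] using hab j h hj
    · simp [glue, h, restrictFn]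

variable {ξ ζ : Set I} {hζ : IsLowerSet ζ} {X : Set (↥ζ → Cantor)}
  {Y : Set (↥ξ → Cantor)}

/-- A point of `X` and a point of `Y` agreeing on `ξ ∩ η` amalgamate to a point of
`X ∩ Y↾⁻¹ζ`. -/
lemma IPe.exists_amalgam_resPre (hX : IPe ζ hζ X) (hξ : IsLowerSet ξ) (hsub : ξ ⊆ ζ)
    (hYsub : Y ⊆ resSet hsub X) {η : Set I} (hη : IsLowerSet η) (hηζ : η ⊆ ζ)
    {x : ↥ζ → Cantor} (hx : x ∈ X) {y : ↥ξ → Cantor} (hy : y ∈ Y)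
    (hxy : ∀ j : ↥ξ, j.1 ∈ η → x ⟨j.1, hsub j.2⟩ = y j) :
    ∃ w ∈ X ∩ resPre hsub Y, ∀ j : ↥ζ, j.1 ∈ η → w j = x j := by
  obtain ⟨b, hb, rfl⟩ := hYsub hy
  obtain ⟨c, hc, hcx, hcb⟩ := hX.exists_amalgam hη hξ hηζ hsub hx hb
    fun j hjη hjξ => hxy ⟨j.1, hjξ⟩ hjη
  refine ⟨c, ⟨hc, ?_⟩, hcx⟩
  have : restrictFn hsub c = restrictFn hsub b := funext fun j => hcb ⟨j.1, hsub j.2⟩ j.2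
  simpa only [resPre, mem_ofPred_eq, this] using hy

/-- For `i ∉ ξ`, the values at `i` over a point of `(X ∩ Y↾⁻¹ζ)↾(<i)` are not constrained
by `Y`. -/
lemma IPe.exists_mem_inter_resPre_of_notMem (hX : IPe ζ hζ X) (hξ : IsLowerSet ξ)
    (hsub : ξ ⊆ ζ) (hYsub : Y ⊆ resSet hsub X) {i : I} (hi : i ∈ ζ) (hiξ : i ∉ ξ)
    {z : ↥(seg i) → Cantor} (hz : z ∈ resSet (seg_subset hζ hi) (X ∩ resPre hsub Y))
    {x : ↥ζ → Cantor} (hx : x ∈ X) (hxz : restrictFn (seg_subset hζ hi) x = z) :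
    ∃ w ∈ X ∩ resPre hsub Y,
      restrictFn (seg_subset hζ hi) w = z ∧ w ⟨i, hi⟩ = x ⟨i, hi⟩ := by
  obtain ⟨v, hv, rfl⟩ := hz
  obtain ⟨w, hw, hwx⟩ := hX.exists_amalgam_resPre hξ hsub hYsub (isLowerSet_segLe i)
    (segLe_subset hζ hi) hx hv.2 fun j hj =>
      congrFun hxz ⟨j.1, lt_of_le_of_ne hj fun h => hiξ (h ▸ j.2)⟩
  refine ⟨w, hw, ?_, hwx ⟨i, hi⟩ (mem_segLe_self i)⟩
  rw [← hxz]
  exact funext fun j => hwx _ (seg_subset_segLe i j.2)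

lemma Dxz_resSet (hsub : ξ ⊆ ζ) (X : Set (↥ζ → Cantor)) {i : I} (hi : i ∈ ξ)
    (h : seg i ⊆ ξ) (z : ↥(seg i) → Cantor) :
    Dxz (resSet hsub X) hi h z = Dxz X (hsub hi) (h.trans hsub) z := by
  ext c
  exact exists_mem_image

end

theorem stmt2 (I : Type) [PartialOrder I] [Countable I]
    (ξ ζ : Set I) (hξ : IsLowerSet ξ) (hζ : IsLowerSet ζ) (hsub : ξ ⊆ ζ)
    (X : Set (↥ζ → Cantor)) (hX : IPe ζ hζ X)
    (Y : Set (↥ξ → Cantor)) (hY : IPe ξ hξ Y) (hYsub : Y ⊆ resSet hsub X) :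
    IPe ζ hζ (X ∩ resPre hsub Y) := by
  have hYZ := resSet_inter_resPre hsub hYsub
  refine ⟨⟨?_, ?_⟩, ?_, ?_, ?_⟩
  · exact hX.1.1.inter (hY.1.1.preimage (continuous_restrictFn hsub))
  · rw [← hYZ] at hY
    exact hY.1.2.of_image
  · intro i hi z hz
    by_cases hiξ : i ∈ ξ
    · have h := hY.2.1 i hiξ z
      rw [← hYZ, resSet_resSet, Dxz_resSet] at h
      exact h hz
    · convert hX.2.1 i hi z (image_mono inter_subset_left hz) using 1
      refine Subset.antisymm (fun c ⟨x, hx, hxz, hxc⟩ => ⟨x, hx.1, hxz, hxc⟩) ?_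
      rintro c ⟨x, hx, hxz, rfl⟩
      exact hX.exists_mem_inter_resPre_of_notMem hξ hsub hYsub hi hiξ hz hx hxz
  · intro i hi G hG
    by_cases hiξ : i ∈ ξ
    · have h := hY.2.2.1 i hiξ G hG
      rw [← hYZ, resSet_resSet] at h
      convert h using 1
      ext z
      constructor
      · rintro ⟨x, hx, hxG, hxz⟩
        exact ⟨_, ⟨x, hx, rfl⟩, hxG, hxz⟩
      · rintro ⟨_, ⟨x, hx, rfl⟩, hxG, hxz⟩
        exact ⟨x, hx, hxG, hxz⟩
    · obtain ⟨U, hU, hUX⟩ := hX.2.2.1 i hi G hG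
      refine ⟨U, hU, Subset.antisymm ?_ ?_⟩
      · rintro z ⟨x, hx, hxG, rfl⟩
        have hxU : restrictFn (seg_subset hζ hi) x ∈ U ∩ resSet (seg_subset hζ hi) X :=
          hUX ▸ ⟨x, hx.1, hxG, rfl⟩
        exact ⟨hxU.1, x, hx, rfl⟩
      · rintro z ⟨hzU, hz⟩
        have hzX : z ∈ U ∩ resSet (seg_subset hζ hi) X :=
          ⟨hzU, image_mono inter_subset_left hz⟩
        rw [← hUX] at hzX
        obtain ⟨x, hx, hxG, hxz⟩ := hzX
        obtain ⟨w, hw, hwz, hwx⟩ :=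
          hX.exists_mem_inter_resPre_of_notMem hξ hsub hYsub hi hiξ hz hx hxz
        exact ⟨w, hw, by rwa [hwx], hwz⟩
  · rintro σ τ hσ hτ hσζ hτζ _ ⟨a, ha, rfl⟩ _ ⟨b, hb, rfl⟩ hab
    have hab' : ∀ j : ↥ζ, j.1 ∈ σ → j.1 ∈ τ → a j = b j :=
      fun j hjσ hjτ => congrFun hab ⟨j.1, hjσ, hjτ⟩
    obtain ⟨c, hc, hca, hcb⟩ := hX.exists_amalgam hσ hτ hσζ hτζ ha.1 hb.1 hab'
    obtain ⟨y, hy, hya, hyb⟩ := hY.exists_amalgam (hξ.inter hσ) (hξ.inter hτ)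
      inter_subset_left inter_subset_left ha.2 hb.2
      fun j hjσ hjτ => hab' ⟨j.1, hsub j.2⟩ hjσ.2 hjτ.2
    obtain ⟨w, hw, hwc⟩ := hX.exists_amalgam_resPre hξ hsub hYsub (hσ.union hτ)
      (union_subset hσζ hτζ) hc hy fun j hj => by
        rcases hj with hj | hj
        · exact (hca _ hj).trans (hya j ⟨j.2, hj⟩).symm
        · exact (hcb _ hj).trans (hyb j ⟨j.2, hj⟩).symm
    refine ⟨w, hw, funext fun j => ?_⟩
    have hj := hwc ⟨j.1, union_subset hσζ hτζ j.2⟩ j.2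
    by_cases h : j.1 ∈ σ
    · simpa [glue, restrictFn, h] using hj.trans (hca _ h)
    · simpa [glue, restrictFn, h] using hj.trans (hcb _ (j.2.resolve_left h))
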